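/- Let R be a staircase with at least two blocks that has exactly one deletable rectangle r. Then every deletable rectangle of the staircase R ∖ {r} is adjacent to r. -/

import Mathlib

open Set

/-- A block is a closed axis-parallel rectangle `[x1,x2] × [y1,y2]` with `x1 < x2`, `y1 < y2`. -/
def IsBlock (b : Set (ℝ × ℝ)) : Prop :=
  ∃ x1 x2 y1 y2 : ℝ, x1 < x2 ∧ y1 < y2 ∧ b = Icc x1 x2 ×ˢ Icc y1 y2

/-- `R` is a staircase with `m` steps, step x-coordinates `a 0 < a 1 < ⋯ < a m`
(with `a 0 = 0`) and step heights `h 1 > h 2 > ⋯ > h m > 0`. -/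
def IsStaircaseWith (R : Finset (Set (ℝ × ℝ))) (m : ℕ) (a h : ℕ → ℝ) : Prop :=
  R.Nonempty ∧
  (∀ b ∈ R, IsBlock b) ∧
  (∀ b ∈ R, ∀ b' ∈ R, b ≠ b' → interior b ∩ interior b' = ∅) ∧
  (∀ (p : ℝ × ℝ) (b1 b2 b3 b4 : Set (ℝ × ℝ)),
      b1 ∈ R → b2 ∈ R → b3 ∈ R → b4 ∈ R →
      p ∈ b1 → p ∈ b2 → p ∈ b3 → p ∈ b4 →
      b1 = b2 ∨ b1 = b3 ∨ b1 = b4 ∨ b2 = b3 ∨ b2 = b4 ∨ b3 = b4) ∧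
  1 ≤ m ∧
  a 0 = 0 ∧
  (∀ j, j < m → a j < a (j + 1)) ∧
  (∀ j, 1 ≤ j → j < m → h (j + 1) < h j) ∧
  0 < h m ∧
  ⋃₀ (R : Set (Set (ℝ × ℝ))) =
    ⋃ j ∈ Finset.Icc 1 m, Icc (a (j - 1)) (a j) ×ˢ Icc (0 : ℝ) (h j)

/-- `R` is a staircase. -/
def IsStaircase (R : Finset (Set (ℝ × ℝ))) : Prop :=
  ∃ m a h, IsStaircaseWith R m a h

/-- `r` is a deletable rectangle of `R`: a block of `R` whose top edge and right
edge are both contained in the topological boundary of `⋃ R`. -/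
def IsDeletable (R : Finset (Set (ℝ × ℝ))) (r : Set (ℝ × ℝ)) : Prop :=
  r ∈ R ∧ ∃ x1 x2 y1 y2 : ℝ, x1 < x2 ∧ y1 < y2 ∧ r = Icc x1 x2 ×ˢ Icc y1 y2 ∧
    (Icc x1 x2 ×ˢ ({y2} : Set ℝ)) ⊆ frontier (⋃₀ (R : Set (Set (ℝ × ℝ)))) ∧
    (({x2} : Set ℝ) ×ˢ Icc y1 y2) ⊆ frontier (⋃₀ (R : Set (Set (ℝ × ℝ))))

/-- A mosaic floorplan is a staircase with exactly one step. -/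
def IsMosaicFloorplan (M : Finset (Set (ℝ × ℝ))) : Prop :=
  ∃ a h, IsStaircaseWith M 1 a h

noncomputable instance : DecidableEq (Set (ℝ × ℝ)) := Classical.decEq _

/-- A horizontal line segment of positive length. -/
def IsHSeg (s : Set (ℝ × ℝ)) : Prop :=
  ∃ x1 x2 y : ℝ, x1 < x2 ∧ s = Icc x1 x2 ×ˢ ({y} : Set ℝ)

/-- A vertical line segment of positive length. -/
def IsVSeg (s : Set (ℝ × ℝ)) : Prop :=
  ∃ x y1 y2 : ℝ, y1 < y2 ∧ s = ({x} : Set ℝ) ×ˢ Icc y1 y2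

/-- `Γ`, the union of the boundaries of the blocks of `M`. -/
def SegUnion (M : Finset (Set (ℝ × ℝ))) : Set (ℝ × ℝ) :=
  ⋃ b ∈ M, frontier b

/-- A maximal horizontal segment of `M`: a horizontal segment contained in `Γ`
that is maximal with respect to inclusion among such segments. -/
def MaxHSeg (M : Finset (Set (ℝ × ℝ))) (s : Set (ℝ × ℝ)) : Prop :=
  IsHSeg s ∧ s ⊆ SegUnion M ∧
    ∀ s', IsHSeg s' → s' ⊆ SegUnion M → s ⊆ s' → s' = s

/-- A maximal vertical segment of `M`. -/
def MaxVSeg (M : Finset (Set (ℝ × ℝ))) (s : Set (ℝ × ℝ)) : Prop :=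
  IsVSeg s ∧ s ⊆ SegUnion M ∧
    ∀ s', IsVSeg s' → s' ⊆ SegUnion M → s ⊆ s' → s' = s

/-- `M` is in standard form:
* for every maximal horizontal segment `h` (at height `y`), every maximal vertical
  segment intersecting `h` that lies in the closed half-plane above the line of `h`
  has x-coordinate strictly greater than that of every maximal vertical segment
  intersecting `h` lying in the closed half-plane below that line;
* for every maximal vertical segment `v` (at abscissa `x`), every maximal horizontal
  segment intersecting `v` lying in the closed half-plane to the right of the line
  of `v` has y-coordinate strictly greater than that of every maximal horizontal
  segment intersecting `v` lying in the closed half-plane to the left of that line. -/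
def StandardForm (M : Finset (Set (ℝ × ℝ))) : Prop :=
  (∀ x1 x2 y : ℝ, x1 < x2 → MaxHSeg M (Icc x1 x2 ×ˢ ({y} : Set ℝ)) →
    ∀ xa ya1 ya2 : ℝ, ya1 < ya2 → MaxVSeg M (({xa} : Set ℝ) ×ˢ Icc ya1 ya2) →
      ((({xa} : Set ℝ) ×ˢ Icc ya1 ya2) ∩ (Icc x1 x2 ×ˢ ({y} : Set ℝ))).Nonempty →
      y ≤ ya1 →
    ∀ xb yb1 yb2 : ℝ, yb1 < yb2 → MaxVSeg M (({xb} : Set ℝ) ×ˢ Icc yb1 yb2) →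
      ((({xb} : Set ℝ) ×ˢ Icc yb1 yb2) ∩ (Icc x1 x2 ×ˢ ({y} : Set ℝ))).Nonempty →
      yb2 ≤ y →
    xb < xa) ∧
  (∀ x y1 y2 : ℝ, y1 < y2 → MaxVSeg M (({x} : Set ℝ) ×ˢ Icc y1 y2) →
    ∀ ya xa1 xa2 : ℝ, xa1 < xa2 → MaxHSeg M (Icc xa1 xa2 ×ˢ ({ya} : Set ℝ)) →
      ((Icc xa1 xa2 ×ˢ ({ya} : Set ℝ)) ∩ (({x} : Set ℝ) ×ˢ Icc y1 y2)).Nonempty →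
      x ≤ xa1 →
    ∀ yb xb1 xb2 : ℝ, xb1 < xb2 → MaxHSeg M (Icc xb1 xb2 ×ˢ ({yb} : Set ℝ)) →
      ((Icc xb1 xb2 ×ˢ ({yb} : Set ℝ)) ∩ (({x} : Set ℝ) ×ˢ Icc y1 y2)).Nonempty →
      xb2 ≤ x →
    yb < ya)

/-- Two blocks are adjacent if their intersection is a line segment of positive
length. -/
def Adjacent (b b' : Set (ℝ × ℝ)) : Prop :=
  ∃ s : Set (ℝ × ℝ), (IsHSeg s ∨ IsVSeg s) ∧ b ∩ b' = s

/-- Two boxes with disjoint interiors are separated in one of the coordinates. -/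
theorem box_separated {x1 x2 y1 y2 u1 u2 v1 v2 : ℝ} (hx : x1 < x2) (hy : y1 < y2)
    (hu : u1 < u2) (hv : v1 < v2)
    (h : interior (Icc x1 x2 ×ˢ Icc y1 y2) ∩ interior (Icc u1 u2 ×ˢ Icc v1 v2) = ∅) :
    x2 ≤ u1 ∨ u2 ≤ x1 ∨ y2 ≤ v1 ∨ v2 ≤ y1 := by
  simp only [interior_prod_eq, interior_Icc, prod_inter_prod, Ioo_inter_Ioo,
    prod_eq_empty_iff, Ioo_eq_empty_iff, not_lt, min_le_iff, le_max_iff] at h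
  grind

theorem IsBlock.isClosed {b : Set (ℝ × ℝ)} (hb : IsBlock b) : IsClosed b := by
  obtain ⟨x1, x2, y1, y2, -, -, rfl⟩ := hb
  exact isClosed_Icc.prod isClosed_Icc

/-- If `p` is interior to a finite union of blocks and is a limit of points of `N`, some block
contains `p` and meets `N`. -/
theorem exists_block_meeting {R : Finset (Set (ℝ × ℝ))} (hR : ∀ b ∈ R, IsBlock b)
    {p : ℝ × ℝ} (hp : p ∈ interior (⋃₀ (R : Set (Set (ℝ × ℝ))))) {N : Set (ℝ × ℝ)}
    (hN : p ∈ closure N) : ∃ b ∈ R, p ∈ b ∧ (b ∩ N).Nonempty := by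
  have h := closure_mono (inter_subset_inter_left N interior_subset)
    (isOpen_interior.inter_closure ⟨hp, hN⟩)
  rw [sUnion_eq_biUnion, iUnion₂_inter, R.finite_toSet.closure_biUnion] at h
  obtain ⟨b, hb, hpb⟩ := mem_iUnion₂.1 h
  exact ⟨b, hb, (hR b hb).isClosed.closure_subset_iff.2 inter_subset_left hpb,
    closure_nonempty_iff.1 ⟨p, hpb⟩⟩

/-- A point interior to the union of all blocks, but on the boundary of the union of the blocks
other than `r`, lies in `r`. -/
theorem mem_of_mem_frontier_erase {R : Finset (Set (ℝ × ℝ))} {r : Set (ℝ × ℝ)}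
    (hr : IsClosed r) {p : ℝ × ℝ} (hp : p ∈ interior (⋃₀ (R : Set (Set (ℝ × ℝ)))))
    (hp' : p ∈ frontier (⋃₀ ((R.erase r : Finset (Set (ℝ × ℝ))) : Set (Set (ℝ × ℝ))))) :
    p ∈ r := by
  by_contra hpr
  refine hp'.2 (interior_maximal (t := interior (⋃₀ (R : Set (Set (ℝ × ℝ)))) ∩ rᶜ) ?_
    (isOpen_interior.inter hr.isOpen_compl) ⟨hp, hpr⟩)
  rintro q ⟨hq, hqr⟩
  obtain ⟨b, hb, hqb⟩ := interior_subset hq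
  refine ⟨b, ?_, hqb⟩
  simp only [Finset.coe_erase, mem_sdiff, mem_singleton_iff]
  exact ⟨hb, fun h => hqr (h ▸ hqb)⟩

/-- If the corner `(x, y)` shared by the blocks to its upper right and lower left is interior to
the union, then four distinct blocks meet there. -/
theorem corner_not_mem_interior {R : Finset (Set (ℝ × ℝ))} (hR : IsStaircase R)
    {x y x2 y2 x1 y1 : ℝ} (hx2 : x < x2) (hy2 : y < y2) (hx1 : x1 < x) (hy1 : y1 < y)
    (hr : Icc x x2 ×ˢ Icc y y2 ∈ R) (hr' : Icc x1 x ×ˢ Icc y1 y ∈ R) :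
    (x, y) ∉ interior (⋃₀ (R : Set (Set (ℝ × ℝ)))) := by
  intro hp
  obtain ⟨m, a, h, -, hblock, hdisj, hfour, -⟩ := hR
  obtain ⟨b, hb, hpb, q, hqb, hq⟩ := exists_block_meeting hblock hp
    (N := Iio x ×ˢ Ioi y) (by simp [closure_prod_eq])
  obtain ⟨c, hc, hpc, s, hsc, hs⟩ := exists_block_meeting hblock hp
    (N := Ioi x ×ˢ Iio y) (by simp [closure_prod_eq])
  simp only [mem_prod, mem_Iio, mem_Ioi] at hq hs
  have hbr : Icc x x2 ×ˢ Icc y y2 ≠ b := by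
    rintro rfl
    exact absurd hqb.1.1 (not_le.2 hq.1)
  have hbr' : Icc x1 x ×ˢ Icc y1 y ≠ b := by
    rintro rfl
    exact absurd hqb.2.2 (not_le.2 hq.2)
  have hcr : Icc x x2 ×ˢ Icc y y2 ≠ c := by
    rintro rfl
    exact absurd hsc.2.1 (not_le.2 hs.2)
  have hcr' : Icc x1 x ×ˢ Icc y1 y ≠ c := by
    rintro rfl
    exact absurd hsc.1.2 (not_le.2 hs.1)
  have hpr : (x, y) ∈ Icc x x2 ×ˢ Icc y y2 := by simp [hx2.le, hy2.le]
  have hpr' : (x, y) ∈ Icc x1 x ×ˢ Icc y1 y := by simp [hx1.le, hy1.le]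
  have hrr' : Icc x x2 ×ˢ Icc y y2 ≠ Icc x1 x ×ˢ Icc y1 y := by
    intro h
    have : (x2, y) ∈ Icc x1 x ×ˢ Icc y1 y := h ▸ by simp [hx2.le, hy2.le]
    exact absurd this.1.2 (not_le.2 hx2)
  have hbc : b ≠ c := by
    rintro rfl
    obtain ⟨u1, u2, v1, v2, hu, hv, rfl⟩ := hblock b hb
    have := box_separated hx2 hy2 hu hv (hdisj _ hr _ hb hbr)
    simp only [mem_prod, mem_Icc] at hqb hsc
    grind
  rcases hfour (x, y) _ _ b c hr hr' hb hc hpr hpr' hpb hpc with h | h | h | h | h | h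
  exacts [hrr' h, hbr h, hcr h, hbr' h, hcr' h, hbc h]

/-- Let `R` be a staircase with at least two blocks that has
exactly one deletable rectangle `r`. Then every deletable rectangle of the
staircase `R \ {r}` is adjacent to `r`. -/
theorem deletable_of_erase_adjacent (R : Finset (Set (ℝ × ℝ)))
    (hR : IsStaircase R) (hcard : 2 ≤ R.card)
    (r : Set (ℝ × ℝ)) (hr : IsDeletable R r)
    (huniq : ∀ r', IsDeletable R r' → r' = r) :
    ∀ r', IsDeletable (R.erase r) r' → Adjacent r' r := by
  rintro r' ⟨hr'mem, u1, u2, v1, v2, hu, hv, rfl, htop', hright'⟩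
  obtain ⟨hrmem, x1, x2, y1, y2, hx, hy, rfl, htop, hright⟩ := hr
  obtain ⟨hne, hr'R⟩ := Finset.mem_erase.1 hr'mem
  obtain ⟨p, hpr', hpfr', hpfr⟩ : ∃ p ∈ Icc u1 u2 ×ˢ Icc v1 v2,
      p ∈ frontier (⋃₀ ((R.erase (Icc x1 x2 ×ˢ Icc y1 y2) : Finset (Set (ℝ × ℝ))) :
        Set (Set (ℝ × ℝ)))) ∧ p ∉ frontier (⋃₀ (R : Set (Set (ℝ × ℝ)))) := by
    by_contra! hcon
    refine hne (huniq _ ⟨hr'R, u1, u2, v1, v2, hu, hv, rfl, ?_, ?_⟩)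
    · exact fun p hp => hcon p
        (prod_mono_right (singleton_subset_iff.2 (right_mem_Icc.2 hv.le)) hp) (htop' hp)
    · exact fun p hp => hcon p
        (prod_mono_left (singleton_subset_iff.2 (right_mem_Icc.2 hu.le)) hp) (hright' hp)
  have hpint : p ∈ interior (⋃₀ (R : Set (Set (ℝ × ℝ)))) := by
    by_contra hcon
    exact hpfr ⟨subset_closure ⟨_, hr'R, hpr'⟩, hcon⟩
  have hpr : p ∈ Icc x1 x2 ×ˢ Icc y1 y2 :=
    mem_of_mem_frontier_erase (isClosed_Icc.prod isClosed_Icc) hpint hpfr'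
  obtain ⟨px, py⟩ := p
  have hpx : px ≠ x2 := by
    rintro rfl
    exact hpfr (hright ⟨rfl, hpr.2⟩)
  have hpy : py ≠ y2 := by
    rintro rfl
    exact hpfr (htop ⟨hpr.1, rfl⟩)
  have hcorner : ¬ (u2 = x1 ∧ v2 = y1) := by
    rintro ⟨rfl, rfl⟩
    obtain rfl : px = u2 := le_antisymm hpr'.1.2 hpr.1.1
    obtain rfl : py = v2 := le_antisymm hpr'.2.2 hpr.2.1
    exact corner_not_mem_interior hR hx hy hu hv hrmem hr'R hpint
  have hdisj : interior (Icc u1 u2 ×ˢ Icc v1 v2) ∩ interior (Icc x1 x2 ×ˢ Icc y1 y2) = ∅ := by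
    obtain ⟨m, a, h, -, -, hd, -⟩ := hR
    exact hd _ hr'R _ hrmem hne
  have hsep := box_separated hu hv hx hy hdisj
  simp only [mem_prod, mem_Icc] at hpr hpr'
  refine ⟨_, ?_, rfl⟩
  rw [prod_inter_prod, Icc_inter_Icc, Icc_inter_Icc]
  have hcases : (u2 = x1 ∧ max v1 y1 < min v2 y2) ∨ (v2 = y1 ∧ max u1 x1 < min u2 x2) := by
    simp only [max_lt_iff, lt_min_iff]
    grind
  rcases hcases with ⟨rfl, hlt⟩ | ⟨rfl, hlt⟩
  · right
    exact ⟨u2, _, _, hlt, by simp [max_eq_right hu.le, min_eq_left hx.le]⟩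
  · left
    exact ⟨_, _, v2, hlt, by simp [max_eq_right hv.le, min_eq_left hy.le]⟩
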